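/- Let p₂(x) = Σ_{j=1}^{n-1} x_j²/a_j² with a_1, …, a_{n-1} > 0, a nonnegative quadratic form on ℝ^n (not involving x_n), and let q be a nonzero polynomial in n variables. Then the polynomial p₂·q is not harmonic, i.e., Δ(p₂·q) ≠ 0. -/

import Mathlib

open MvPolynomial Filter

/-- The Laplacian of a polynomial: `Δp = ∑ ∂²p/∂x_i²`. -/
noncomputable def polyLap {n : ℕ} (p : MvPolynomial (Fin n) ℝ) : MvPolynomial (Fin n) ℝ :=
  ∑ i, pderiv i (pderiv i p)

open MeasureTheory in
theorem integrable_pow_mul_exp_neg_half_sq (k : ℕ) :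
    Integrable fun x : ℝ => x ^ k * Real.exp (-(1 / 2) * x ^ 2) := by
  have hk : (-1 : ℝ) < k := lt_of_lt_of_le (by norm_num) k.cast_nonneg
  simpa only [Real.rpow_natCast] using
    integrable_rpow_mul_exp_neg_mul_sq (b := 1 / 2) (by norm_num) hk

open MeasureTheory in
theorem integral_pow_succ_mul_exp_neg_half_sq (k : ℕ) :
    ∫ x : ℝ, x ^ (k + 1) * Real.exp (-(1 / 2) * x ^ 2) =
      k * ∫ x : ℝ, x ^ (k - 1) * Real.exp (-(1 / 2) * x ^ 2) := by
  have hderiv (x : ℝ) : HasDerivAt (fun x : ℝ => x ^ k * Real.exp (-(1 / 2) * x ^ 2))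
      (k * (x ^ (k - 1) * Real.exp (-(1 / 2) * x ^ 2)) -
        x ^ (k + 1) * Real.exp (-(1 / 2) * x ^ 2)) x := by
    refine ((hasDerivAt_pow k x).mul
      (((hasDerivAt_pow 2 x).const_mul (-(1 / 2))).exp)).congr_deriv ?_
    norm_num
    ring
  have hint := (integrable_pow_mul_exp_neg_half_sq (k - 1)).const_mul (k : ℝ)
  have h := integral_eq_zero_of_hasDerivAt_of_integrable hderiv
    (hint.sub (integrable_pow_mul_exp_neg_half_sq (k + 1))) (integrable_pow_mul_exp_neg_half_sq k)
  rw [integral_sub hint (integrable_pow_mul_exp_neg_half_sq (k + 1)), integral_const_mul] at h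
  linarith

section GaussianIntegral

open MeasureTheory

variable {σ : Type*} [Fintype σ]

theorem eval_monomial_one_mul_prod_exp (s : σ →₀ ℕ) (x : σ → ℝ) :
    eval x (monomial s (1 : ℝ)) * ∏ i, Real.exp (-(1 / 2) * x i ^ 2) =
      ∏ i, x i ^ s i * Real.exp (-(1 / 2) * x i ^ 2) := by
  rw [eval_monomial, one_mul, Finsupp.prod_fintype _ _ (by simp), Finset.prod_mul_distrib]

theorem integrable_eval_mul_prod_exp (p : MvPolynomial σ ℝ) :
    Integrable fun x : σ → ℝ => eval x p * ∏ i, Real.exp (-(1 / 2) * x i ^ 2) := by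
  induction p using MvPolynomial.induction_on' with
  | monomial s c =>
    have h : Integrable fun x : σ → ℝ => ∏ i, x i ^ s i * Real.exp (-(1 / 2) * x i ^ 2) :=
      Integrable.fintype_prod fun i => integrable_pow_mul_exp_neg_half_sq (s i)
    refine (h.const_mul c).congr (.of_forall fun x => ?_)
    simp only [← eval_monomial_one_mul_prod_exp, eval_monomial]
    ring
  | add p q hp hq =>
    simp only [map_add, add_mul]
    exact hp.add hq

/-- Unnormalized expectation of a polynomial under the standard Gaussian measure. -/
noncomputable def gaussianIntegral : MvPolynomial σ ℝ →ₗ[ℝ] ℝ where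
  toFun p := ∫ x : σ → ℝ, eval x p * ∏ i, Real.exp (-(1 / 2) * x i ^ 2)
  map_add' p q := by
    simp only [map_add, add_mul]
    exact integral_add (integrable_eval_mul_prod_exp p) (integrable_eval_mul_prod_exp q)
  map_smul' c p := by
    simp only [smul_eval, mul_assoc, integral_const_mul, RingHom.id_apply, smul_eq_mul]

theorem gaussianIntegral_monomial_one (s : σ →₀ ℕ) :
    gaussianIntegral (monomial s (1 : ℝ)) =
      ∏ i, ∫ x : ℝ, x ^ s i * Real.exp (-(1 / 2) * x ^ 2) := by
  simp only [gaussianIntegral, LinearMap.coe_mk, AddHom.coe_mk, eval_monomial_one_mul_prod_exp]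
  exact integral_fintype_prod_volume_eq_prod
    fun i (x : ℝ) => x ^ s i * Real.exp (-(1 / 2) * x ^ 2)

theorem gaussianIntegral_X_mul (i : σ) (p : MvPolynomial σ ℝ) :
    gaussianIntegral (X i * p) = gaussianIntegral (pderiv i p) := by
  classical
  suffices h : gaussianIntegral ∘ₗ LinearMap.mulLeft ℝ (X i) =
      gaussianIntegral ∘ₗ (pderiv i).toLinearMap from LinearMap.congr_fun h p
  refine MvPolynomial.linearMap_ext fun s => LinearMap.ext_ring ?_
  have hX : X i * monomial s (1 : ℝ) = monomial (s + Finsupp.single i 1) 1 := by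
    rw [X, monomial_mul, one_mul, add_comm]
  have hpderiv : pderiv i (monomial s (1 : ℝ)) =
      (s i : ℝ) • monomial (s - Finsupp.single i 1) 1 := by
    rw [pderiv_monomial, smul_monomial, one_mul, smul_eq_mul, mul_one]
  simp only [LinearMap.comp_apply, LinearMap.mulLeft_apply, Derivation.coeFn_coe,
    hX, hpderiv, map_smul, gaussianIntegral_monomial_one]
  rw [← Finset.mul_prod_erase _ _ (Finset.mem_univ i),
    ← Finset.mul_prod_erase _ _ (Finset.mem_univ i), smul_eq_mul, ← mul_assoc]
  congr 1
  · simpa using integral_pow_succ_mul_exp_neg_half_sq (s i)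
  · refine Finset.prod_congr rfl fun j hj => ?_
    have hji : i ≠ j := (Finset.ne_of_mem_erase hj).symm
    simp [Finsupp.single_eq_of_ne' hji]

theorem gaussianIntegral_pos {p : MvPolynomial σ ℝ} (hp : p ≠ 0)
    (hnonneg : ∀ x, 0 ≤ eval x p) : 0 < gaussianIntegral p := by
  obtain ⟨x, hx⟩ : ∃ x, eval x p ≠ 0 := by
    by_contra! h
    exact hp (MvPolynomial.funext fun x => by simpa using h x)
  have hexp (x : σ → ℝ) : 0 < ∏ i, Real.exp (-(1 / 2) * x i ^ 2) :=
    Finset.prod_pos fun i _ => Real.exp_pos _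
  refine integral_pos_of_integrable_nonneg_nonzero (x := x) ?_ (integrable_eval_mul_prod_exp p)
    (fun x => mul_nonneg (hnonneg x) (hexp x).le) (mul_ne_zero hx (hexp x).ne')
  exact (continuous_eval p).mul (by fun_prop)

end GaussianIntegral

theorem pderiv_comm {σ R : Type*} [CommRing R] (i j : σ) (p : MvPolynomial σ R) :
    pderiv i (pderiv j p) = pderiv j (pderiv i p) := by
  classical
  have h : ⁅pderiv (R := R) i, pderiv (R := R) j⁆ = 0 := by
    refine MvPolynomial.derivation_ext fun k => ?_
    simp [Derivation.commutator_apply, pderiv_X, Pi.single_apply, apply_ite]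
  have hp := DFunLike.congr_fun h p
  rwa [Derivation.commutator_apply, Derivation.zero_apply, sub_eq_zero] at hp

section Laplacian

variable {n : ℕ}

theorem polyLap_pderiv (i : Fin n) (p : MvPolynomial (Fin n) ℝ) :
    polyLap (pderiv i p) = pderiv i (polyLap p) := by
  simp only [polyLap, map_sum]
  refine Finset.sum_congr rfl fun j _ => ?_
  rw [pderiv_comm j i p, pderiv_comm j i]

theorem polyLap_sum {ι : Type*} (s : Finset ι) (f : ι → MvPolynomial (Fin n) ℝ) :
    polyLap (∑ k ∈ s, f k) = ∑ k ∈ s, polyLap (f k) := by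
  simp only [polyLap, map_sum]
  exact Finset.sum_comm

theorem MvPolynomial.IsHomogeneous.polyLap {p : MvPolynomial (Fin n) ℝ} {d : ℕ}
    (hp : p.IsHomogeneous (d + 2)) : (polyLap p).IsHomogeneous d :=
  IsHomogeneous.sum _ _ _ fun _ _ => hp.pderiv.pderiv

/-- A homogeneous harmonic polynomial is Gaussian-orthogonal to homogeneous polynomials of lower
degree. -/
theorem gaussianIntegral_mul_eq_zero_of_polyLap_eq_zero {k m : ℕ} (hmk : m < k)
    {p q : MvPolynomial (Fin n) ℝ} (hp : p.IsHomogeneous k) (hharm : polyLap p = 0)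
    (hq : q.IsHomogeneous m) : gaussianIntegral (p * q) = 0 := by
  induction k generalizing m p q with
  | zero => omega
  | succ k ih =>
    have hcross (i : Fin n) : gaussianIntegral (pderiv i p * pderiv i q) = 0 := by
      rcases Nat.eq_zero_or_pos m with rfl | hm
      · rw [totalDegree_eq_zero_iff_eq_C.mp (Nat.le_zero.mp hq.totalDegree_le)]
        simp
      · exact ih (by omega) hp.pderiv (by rw [polyLap_pderiv, hharm, map_zero]) hq.pderiv
    have heuler : ((k + 1 : ℕ) : ℝ) * gaussianIntegral (p * q) = 0 := calc
      _ = gaussianIntegral (((k + 1) • p) * q) := by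
        rw [smul_mul_assoc, map_nsmul, nsmul_eq_mul]
      _ = ∑ i, gaussianIntegral (X i * (pderiv i p * q)) := by
        simp only [← hp.sum_X_mul_pderiv, Finset.sum_mul, map_sum, mul_assoc]
      _ = ∑ i, gaussianIntegral (pderiv i (pderiv i p) * q) := by
        simp only [gaussianIntegral_X_mul, pderiv_mul, map_add, hcross, add_zero]
      _ = gaussianIntegral (polyLap p * q) := by
        rw [polyLap, Finset.sum_mul, map_sum]
      _ = 0 := by rw [hharm, zero_mul, map_zero]
    exact (mul_eq_zero.mp heuler).resolve_left (by positivity)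

theorem polyLap_mul_homogeneousComponent {p : MvPolynomial (Fin n) ℝ} (hp : p.IsHomogeneous 2)
    (q : MvPolynomial (Fin n) ℝ) (d : ℕ) :
    polyLap (p * homogeneousComponent d q) = homogeneousComponent d (polyLap (p * q)) := by
  have hhom (e : ℕ) : (polyLap (p * homogeneousComponent e q)).IsHomogeneous e := by
    refine IsHomogeneous.polyLap ?_
    rw [add_comm]
    exact hp.mul (homogeneousComponent_isHomogeneous e q)
  conv_rhs => rw [← sum_homogeneousComponent q]
  simp only [Finset.mul_sum, polyLap_sum, map_sum, homogeneousComponent_of_mem (hhom _)]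
  rw [Finset.sum_ite_eq]
  split_ifs with hd
  · rfl
  · rw [homogeneousComponent_eq_zero d q (by simpa [Nat.lt_succ_iff] using hd), mul_zero]
    simp [polyLap]

/-- A nonzero multiple of a nonzero nonnegative quadratic form is not harmonic. -/
theorem polyLap_mul_ne_zero_of_nonneg {p : MvPolynomial (Fin n) ℝ} (hp : p.IsHomogeneous 2)
    (hp0 : p ≠ 0) (hnonneg : ∀ x, 0 ≤ eval x p) {q : MvPolynomial (Fin n) ℝ} (hq : q ≠ 0) :
    polyLap (p * q) ≠ 0 := by
  intro h
  obtain ⟨d, hd⟩ : ∃ d, homogeneousComponent d q ≠ 0 := by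
    by_contra! h0
    exact hq (by rw [← sum_homogeneousComponent q]; simp [h0])
  set r := homogeneousComponent d q with hr
  have hrhom : r.IsHomogeneous d := homogeneousComponent_isHomogeneous d q
  have hzero : gaussianIntegral (p * r * r) = 0 :=
    gaussianIntegral_mul_eq_zero_of_polyLap_eq_zero (by omega) (hp.mul hrhom)
      (by rw [hr, polyLap_mul_homogeneousComponent hp, h, map_zero]) hrhom
  refine (gaussianIntegral_pos (mul_ne_zero (mul_ne_zero hp0 hd) hd) fun x => ?_).ne' hzero
  rw [mul_assoc, map_mul, map_mul]
  exact mul_nonneg (hnonneg x) (mul_self_nonneg _)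

end Laplacian

/-- Brelot–Choquet (special case): for the nonnegative quadratic form
`p₂ = ∑_{j<n-1} x_j²/a_j²` and any nonzero polynomial `q`, the product `p₂·q`
is not harmonic. -/
theorem quadratic_times_poly_not_harmonic
    (n : ℕ) (hn : 2 ≤ n) (a : Fin (n - 1) → ℝ) (ha : ∀ j, 0 < a j)
    (q : MvPolynomial (Fin n) ℝ) (hq : q ≠ 0) :
    polyLap ((∑ j : Fin (n - 1),
      C ((a j) ^ 2)⁻¹ * (X (Fin.castLE (Nat.sub_le n 1) j)) ^ 2) * q) ≠ 0 := by
  refine polyLap_mul_ne_zero_of_nonneg ?_ ?_ ?_ hq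
  · exact IsHomogeneous.sum _ _ _ fun j _ => isHomogeneous_C_mul_X_pow _ _ _
  · intro h
    have heval := congrArg (eval fun _ => (1 : ℝ)) h
    simp only [map_sum, map_mul, map_pow, eval_C, eval_X, one_pow, mul_one, map_zero] at heval
    have : Nonempty (Fin (n - 1)) := ⟨⟨0, by omega⟩⟩
    exact (Finset.sum_pos (fun j _ => inv_pos.mpr (pow_pos (ha j) 2))
      Finset.univ_nonempty).ne' heval
  · intro x
    simp only [map_sum, map_mul, map_pow, eval_C, eval_X]
    exact Finset.sum_nonneg fun j _ => by positivity
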